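/- (Structural completeness from projective covers) Let φ be a consistent formula of propositional team logic and suppose there is a finite family {φᵢ : i∈I} of F-projective formulas such that φᵢ ⊨ φ for every i∈I and every team satisfying φ satisfies φᵢ for some i∈I. Then for every formula ψ: if for every flat substitution σ, ⊨ σ(φ) implies ⊨ σ(ψ), then φ ⊨ ψ. -/

import Mathlib

inductive PTForm : Type
  | var : ℕ → PTForm
  | bot : PTForm
  | top : PTForm
  | neg : PTForm → PTForm
  | conj : PTForm → PTForm → PTForm
  | tensor : PTForm → PTForm → PTForm
  | disj : PTForm → PTForm → PTForm
  | impl : PTForm → PTForm → PTForm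
  | dep : List PTForm → PTForm → PTForm

abbrev Val := ℕ → Bool
abbrev Team := Set Val

def PTSat : Team → PTForm → Prop
  | X, .var n => ∀ v ∈ X, v n = true
  | X, .bot => X = ∅
  | _, .top => True
  | X, .neg φ => ∀ v ∈ X, ¬ PTSat {v} φ
  | X, .conj φ ψ => PTSat X φ ∧ PTSat X ψ
  | X, .tensor φ ψ => ∃ Y Z, X = Y ∪ Z ∧ PTSat Y φ ∧ PTSat Z ψ
  | X, .disj φ ψ => PTSat X φ ∨ PTSat X ψ
  | X, .impl φ ψ => ∀ Y ⊆ X, PTSat Y φ → PTSat Y ψ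
  | X, .dep l ψ => ∀ Y ⊆ X,
      (∀ φ ∈ l, PTSat Y φ ∨ (∀ v ∈ Y, ¬ PTSat {v} φ)) →
      (PTSat Y ψ ∨ (∀ v ∈ Y, ¬ PTSat {v} ψ))

def PTValid (φ : PTForm) : Prop := ∀ X : Team, PTSat X φ
def PTConseq (φ ψ : PTForm) : Prop := ∀ X : Team, PTSat X φ → PTSat X ψ
def PTEquiv (φ ψ : PTForm) : Prop := ∀ X : Team, PTSat X φ ↔ PTSat X ψ
def PTSetConseq (Γ : Set PTForm) (φ : PTForm) : Prop :=
  ∀ X : Team, (∀ ψ ∈ Γ, PTSat X ψ) → PTSat X φ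
def Flat (φ : PTForm) : Prop :=
  ∀ X : Team, PTSat X φ ↔ ∀ v ∈ X, PTSat {v} φ

/-- All propositional variables of a formula are among `p_0, …, p_{n-1}`. -/
def VarsBelow (n : ℕ) : PTForm → Prop
  | .var m => m < n
  | .bot => True
  | .top => True
  | .neg φ => VarsBelow n φ
  | .conj φ ψ => VarsBelow n φ ∧ VarsBelow n ψ
  | .tensor φ ψ => VarsBelow n φ ∧ VarsBelow n ψ
  | .disj φ ψ => VarsBelow n φ ∧ VarsBelow n ψ
  | .impl φ ψ => VarsBelow n φ ∧ VarsBelow n ψ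
  | .dep l ψ => (∀ φ ∈ l, VarsBelow n φ) ∧ VarsBelow n ψ

/-- The restriction of a valuation to the variables `p_0, …, p_{n-1}`. -/
def restrict (n : ℕ) (v : Val) : Fin n → Bool := fun i => v i.val

/-- The team of all valuations whose restriction to `p_0, …, p_{n-1}` lies in
a given team on those variables. -/
def liftTeam (n : ℕ) (Y : Set (Fin n → Bool)) : Team :=
  {w : Val | restrict n w ∈ Y}

/-- Finite intuitionistic disjunction (`⊥` for the empty list). -/
def bigDisj (l : List PTForm) : PTForm := l.foldr .disj .bot

/-- Finite tensor disjunction (`⊥` for the empty list). -/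
def bigTensor (l : List PTForm) : PTForm := l.foldr .tensor .bot

/-- The conjunction `p_0^{v(p_0)} ∧ … ∧ p_{n-1}^{v(p_{n-1})}`,
where `p¹ = p` and `p⁰ = ¬p`. -/
def literal (n : ℕ) (v : Fin n → Bool) : PTForm :=
  (List.finRange n).foldr
    (fun i acc => .conj (if v i then .var i.val else .neg (.var i.val)) acc) .top

open Classical in
/-- `Θ_X := ¬¬⋁_{v∈X} (p_0^{v(p_0)} ∧ … ∧ p_{n-1}^{v(p_{n-1})})` for a nonempty
team `X` on `p_0, …, p_{n-1}`, and `Θ_∅ := ⊥`. -/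
noncomputable def Theta (n : ℕ) (X : Set (Fin n → Bool)) : PTForm :=
  if X = ∅ then .bot
  else .neg (.neg (bigDisj (X.toFinite.toFinset.toList.map (literal n))))

/-- `Θ⊗_X := ⨂_{v∈X} (p_0^{v(p_0)} ∧ … ∧ p_{n-1}^{v(p_{n-1})})`
(the tensor normal form; `⊥` for `X = ∅`). -/
noncomputable def ThetaTensor (n : ℕ) (X : Set (Fin n → Bool)) : PTForm :=
  bigTensor (X.toFinite.toFinset.toList.map (literal n))

abbrev Subst := ℕ → PTForm

def applySubst (σ : Subst) : PTForm → PTForm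
  | .var n => σ n
  | .bot => .bot
  | .top => .top
  | .neg φ => .neg (applySubst σ φ)
  | .conj φ ψ => .conj (applySubst σ φ) (applySubst σ ψ)
  | .tensor φ ψ => .tensor (applySubst σ φ) (applySubst σ ψ)
  | .disj φ ψ => .disj (applySubst σ φ) (applySubst σ ψ)
  | .impl φ ψ => .impl (applySubst σ φ) (applySubst σ ψ)
  | .dep l ψ => .dep (l.attach.map (fun x => applySubst σ x.1)) (applySubst σ ψ)
decreasing_by
  all_goals simp_wf
  all_goals first
    | (have := List.sizeOf_lt_of_mem x.2; omega)
    | omega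

def FlatSubst (σ : Subst) : Prop := ∀ n : ℕ, Flat (σ n)

open Classical in
noncomputable def valSub (σ : Subst) (v : Val) : Val :=
  fun p => if PTSat {v} (σ p) then true else false

noncomputable def teamSub (σ : Subst) (X : Team) : Team := valSub σ '' X

/-- A formula is F-projective if some flat substitution unifies it and is,
modulo the formula, the identity on variables. -/
def FProjective (φ : PTForm) : Prop :=
  ∃ σ : Subst, FlatSubst σ ∧ PTValid (applySubst σ φ) ∧
    ∀ p : ℕ,
      (∀ X : Team, PTSat X φ → PTSat X (σ p) → PTSat X (.var p)) ∧
      (∀ X : Team, PTSat X φ → PTSat X (.var p) → PTSat X (σ p))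

/-- Prucnal's substitution determined by a formula `θ` and a valuation `v` on
`p_0, …, p_{n-1}`: `σ(p) = θ ∧ p` if `v(p) = 0` and `σ(p) = θ → p` if
`v(p) = 1` (identity outside the domain of `v`). -/
def prucnal (θ : PTForm) (n : ℕ) (v : Fin n → Bool) : Subst :=
  fun p => if h : p < n then
      (if v ⟨p, h⟩ then .impl θ (.var p) else .conj θ (.var p))
    else .var p

/-- The variant of Prucnal's substitution used for the tensor normal form:
`σ(p) = θ ∧ p` if `v(p) = 0` and `σ(p) = ¬θ ⊗ p` if `v(p) = 1`. -/
def prucnalT (θ : PTForm) (n : ℕ) (v : Fin n → Bool) : Subst :=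
  fun p => if h : p < n then
      (if v ⟨p, h⟩ then .tensor (.neg θ) (.var p) else .conj θ (.var p))
    else .var p

/-- A formula contains no dependence atoms and no intuitionistic disjunction. -/
def IsClassical : PTForm → Prop
  | .var _ => True
  | .bot => True
  | .top => True
  | .neg φ => IsClassical φ
  | .conj φ ψ => IsClassical φ ∧ IsClassical ψ
  | .tensor φ ψ => IsClassical φ ∧ IsClassical ψ
  | .disj _ _ => False
  | .impl φ ψ => IsClassical φ ∧ IsClassical ψ
  | .dep _ _ => False

/-- Classical truth-table satisfaction by a single valuation, reading `⊗` as
classical disjunction. -/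
def CSat (v : Val) : PTForm → Prop
  | .var n => v n = true
  | .bot => False
  | .top => True
  | .neg φ => ¬ CSat v φ
  | .conj φ ψ => CSat v φ ∧ CSat v ψ
  | .tensor φ ψ => CSat v φ ∨ CSat v ψ
  | .disj φ ψ => CSat v φ ∨ CSat v ψ
  | .impl φ ψ => CSat v φ → CSat v ψ
  | .dep _ _ => True

/-- Formulas of propositional dependence logic (PD): atoms `p`, `¬p`, `⊥`, `⊤`,
dependence atoms with variable arguments, conjunction and tensor. -/
inductive PDForm : Type
  | pos : ℕ → PDForm
  | negv : ℕ → PDForm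
  | bot : PDForm
  | top : PDForm
  | dep : List ℕ → ℕ → PDForm
  | conj : PDForm → PDForm → PDForm
  | tensor : PDForm → PDForm → PDForm

/-- The embedding of PD formulas into PT formulas. -/
def PDForm.toPT : PDForm → PTForm
  | .pos n => .var n
  | .negv n => .neg (.var n)
  | .bot => .bot
  | .top => .top
  | .dep l q => .dep (l.map .var) (.var q)
  | .conj φ ψ => .conj φ.toPT ψ.toPT
  | .tensor φ ψ => .tensor φ.toPT ψ.toPT

/-- The syntactic (De Morgan) negation `φ~` of a PD formula. -/
def PDForm.synNeg : PDForm → PDForm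
  | .pos n => .negv n
  | .negv n => .pos n
  | .bot => .top
  | .top => .bot
  | .dep _ _ => .bot
  | .conj φ ψ => .tensor φ.synNeg ψ.synNeg
  | .tensor φ ψ => .conj φ.synNeg ψ.synNeg

/-- Team satisfaction is closed under subteams. -/
theorem PTSat.mono {X Y : Team} (hYX : Y ⊆ X) : ∀ φ : PTForm, PTSat X φ → PTSat Y φ
  | .var _, h => by
      simp only [PTSat] at h ⊢
      exact fun v hv => h v (hYX hv)
  | .bot, h => by
      simp only [PTSat] at h ⊢
      exact Set.subset_eq_empty hYX h
  | .top, _ => by simp only [PTSat]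
  | .neg _, h => by
      simp only [PTSat] at h ⊢
      exact fun v hv => h v (hYX hv)
  | .conj φ ψ, h => by
      simp only [PTSat] at h ⊢
      exact ⟨mono hYX φ h.1, mono hYX ψ h.2⟩
  | .tensor φ ψ, h => by
      simp only [PTSat] at h ⊢
      obtain ⟨A, B, rfl, hA, hB⟩ := h
      refine ⟨Y ∩ A, Y ∩ B, ?_, mono Set.inter_subset_right φ hA,
        mono Set.inter_subset_right ψ hB⟩
      rw [← Set.inter_union_distrib_left, Set.inter_eq_left.mpr hYX]
  | .disj φ ψ, h => by
      simp only [PTSat] at h ⊢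
      exact h.imp (mono hYX φ) (mono hYX ψ)
  | .impl _ _, h => by
      simp only [PTSat] at h ⊢
      exact fun Z hZ => h Z (hZ.trans hYX)
  | .dep _ _, h => by
      simp only [PTSat] at h ⊢
      exact fun Z hZ => h Z (hZ.trans hYX)

theorem teamSub_singleton (σ : Subst) (v : Val) : teamSub σ {v} = {valSub σ v} :=
  Set.image_singleton

theorem forall_subset_teamSub (σ : Subst) (X : Team) (P : Team → Prop) :
    (∀ Y ⊆ teamSub σ X, P Y) ↔ ∀ Y ⊆ X, P (teamSub σ Y) :=
  Set.forall_subset_image_iff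

theorem forall_mem_teamSub (σ : Subst) (X : Team) (P : Val → Prop) :
    (∀ v ∈ teamSub σ X, P v) ↔ ∀ v ∈ X, P (valSub σ v) :=
  Set.forall_mem_image

/-- Applying a flat substitution to a formula amounts to transforming the team. -/
theorem ptSat_applySubst {σ : Subst} (hσ : FlatSubst σ) :
    ∀ (φ : PTForm) (X : Team), PTSat X (applySubst σ φ) ↔ PTSat (teamSub σ X) φ
  | .var n, X => by
      simp only [PTSat, applySubst, forall_mem_teamSub]
      rw [hσ n X]
      simp [valSub]
  | .bot, X => by simp [PTSat, applySubst, teamSub]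
  | .top, X => by simp only [PTSat, applySubst]
  | .neg φ, X => by
      simp only [PTSat, applySubst, forall_mem_teamSub, ptSat_applySubst hσ φ,
        teamSub_singleton]
  | .conj φ ψ, X => by
      simp only [PTSat, applySubst, ptSat_applySubst hσ φ, ptSat_applySubst hσ ψ]
  | .tensor φ ψ, X => by
      simp only [PTSat, applySubst, ptSat_applySubst hσ φ, ptSat_applySubst hσ ψ]
      constructor
      · rintro ⟨Y, Z, rfl, hY, hZ⟩
        exact ⟨_, _, Set.image_union _ _ _, hY, hZ⟩
      · rintro ⟨Y, Z, h, hY, hZ⟩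
        have himage (W : Team) (hW : W ⊆ teamSub σ X) :
            teamSub σ (X ∩ valSub σ ⁻¹' W) = W := by
          rw [teamSub, Set.image_inter_preimage]
          exact Set.inter_eq_right.mpr hW
        refine ⟨X ∩ valSub σ ⁻¹' Y, X ∩ valSub σ ⁻¹' Z, ?_, ?_, ?_⟩
        · rw [← Set.inter_union_distrib_left, ← Set.preimage_union, ← h]
          exact (Set.inter_eq_left.mpr (Set.subset_preimage_image _ _)).symm
        · rwa [himage Y (h ▸ Set.subset_union_left)]
        · rwa [himage Z (h ▸ Set.subset_union_right)]
  | .disj φ ψ, X => by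
      simp only [PTSat, applySubst, ptSat_applySubst hσ φ, ptSat_applySubst hσ ψ]
  | .impl φ ψ, X => by
      simp only [PTSat, applySubst, forall_subset_teamSub, ptSat_applySubst hσ φ,
        ptSat_applySubst hσ ψ]
  | .dep l ψ, X => by
      have hl : ∀ χ ∈ l, ∀ Y, PTSat Y (applySubst σ χ) ↔ PTSat (teamSub σ Y) χ :=
        fun χ _ => ptSat_applySubst hσ χ
      simp only [PTSat, applySubst, forall_subset_teamSub, forall_mem_teamSub,
        ptSat_applySubst hσ ψ, teamSub_singleton]
      refine forall₂_congr fun Y _ => imp_congr_left ?_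
      simp only [List.map_attach_eq_pmap, List.pmap_eq_map, List.forall_mem_map]
      refine forall₂_congr fun χ hχ => ?_
      simp only [hl χ hχ, teamSub_singleton]

/-- Structural completeness from projective covers. -/
theorem pt_structural_completeness (φ : PTForm)
    (hcons : ∃ X : Team, X.Nonempty ∧ PTSat X φ)
    (l : List PTForm)
    (hproj : ∀ χ ∈ l, FProjective χ)
    (hunder : ∀ χ ∈ l, PTConseq χ φ)
    (hcover : ∀ X : Team, PTSat X φ → ∃ χ ∈ l, PTSat X χ)
    (ψ : PTForm)
    (hadm : ∀ σ : Subst, FlatSubst σ →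
      PTValid (applySubst σ φ) → PTValid (applySubst σ ψ)) :
    PTConseq φ ψ := by
  intro X hX
  obtain ⟨χ, hχ, hXχ⟩ := hcover X hX
  obtain ⟨σ, hσ, hvalid, hid⟩ := hproj χ hχ
  have hψ := (ptSat_applySubst hσ ψ X).1 <| hadm σ hσ (fun Y =>
    (ptSat_applySubst hσ φ Y).2 <| hunder χ hχ _ <| (ptSat_applySubst hσ χ Y).1 (hvalid Y)) X
  have hfix : ∀ v ∈ X, valSub σ v = v := by
    intro v hv
    have hvχ : PTSat {v} χ := PTSat.mono (Set.singleton_subset_iff.mpr hv) χ hXχ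
    funext p
    have hp : PTSat {v} (σ p) ↔ v p = true := by
      have := Iff.intro ((hid p).1 {v} hvχ) ((hid p).2 {v} hvχ)
      simpa [PTSat] using this
    simp [valSub, hp]
  rwa [teamSub, Set.image_congr hfix, Set.image_id'] at hψ
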